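/- arXiv:0909.4190 — 3 statements merged into one kernel-verified Lean document; each statement's English description precedes it below -/
import Mathlib

section
/- Let K be a field of characteristic 0, let e ≥ 1, and let u_1, …, u_e ∈ K be nonzero and pairwise distinct. If the product ∏_{k ≠ i} u_k/(u_k − u_i) (taken over 1 ≤ k ≤ e with k ≠ i) does not depend on i ∈ {1, …, e}, then there exist y ∈ K, y ≠ 0, and a primitive e-th root of unity ζ ∈ K such that {u_i : 1 ≤ i ≤ e} = {ζ^i · y : 1 ≤ i ≤ e}. -/
/-- **Equal Schur elements for the cyclic group force parameters in geometric
progression by roots of unity.**  Let `K` be a field of characteristic `0`, `e ≥ 1`,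
and `u 1, …, u e ∈ K` nonzero and pairwise distinct.  If the product
`∏_{k ≠ i} u k / (u k - u i)` does not depend on `i`, then there are `y ≠ 0` and a
primitive `e`-th root of unity `ζ ∈ K` with `{u i} = {ζ^i · y : 1 ≤ i ≤ e}`. -/
theorem cyclic_schur_elements_equal
    (K : Type*) [Field K] [CharZero K] (e : ℕ) (he : 1 ≤ e)
    (u : Fin e → K) (hu0 : ∀ i, u i ≠ 0) (huinj : Function.Injective u)
    (hprod : ∀ i i' : Fin e,
      (∏ k ∈ Finset.univ.erase i, u k / (u k - u i)) =
      (∏ k ∈ Finset.univ.erase i', u k / (u k - u i'))) :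
    ∃ y : K, y ≠ 0 ∧ ∃ ζ : K, IsPrimitiveRoot ζ e ∧
      Set.range u = Set.range (fun i : Fin e => ζ ^ ((i : ℕ) + 1) * y) := by
  classical
  have : NeZero e := ⟨by omega⟩
  let i0 : Fin e := ⟨0, by omega⟩
  obtain ⟨c, hc⟩ : ∃ c : K, ∀ i, u i * ∏ k ∈ Finset.univ.erase i, (u i - u k) = c := by
    refine ⟨(-1) ^ (e - 1) * ((∏ k, u k) / ∏ k ∈ Finset.univ.erase i0, u k / (u k - u i0)), ?_⟩
    intro i
    rw [← hprod i i0, Finset.prod_div_distrib, ← Finset.mul_prod_erase _ u (Finset.mem_univ i)]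
    have h1 : ∏ k ∈ Finset.univ.erase i, u k ≠ 0 := Finset.prod_ne_zero_iff.mpr fun k _ => hu0 k
    have h2 : ∏ k ∈ Finset.univ.erase i, (u k - u i) ≠ 0 := Finset.prod_ne_zero_iff.mpr
      fun k hk => sub_ne_zero.mpr (huinj.ne (Finset.ne_of_mem_erase hk))
    have h3 : ∏ k ∈ Finset.univ.erase i, (u i - u k)
        = (-1) ^ (e - 1) * ∏ k ∈ Finset.univ.erase i, (u k - u i) := by
      have hcard : (Finset.univ.erase i).card = e - 1 := by simp
      rw [← hcard, ← Finset.prod_const, ← Finset.prod_mul_distrib]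
      exact Finset.prod_congr rfl fun k _ => by ring
    rw [h3]
    field_simp
  set P : Polynomial K := Lagrange.nodal Finset.univ u with hP
  have hdeg : P.natDegree = e := by rw [hP, Lagrange.natDegree_nodal]; simp
  have hmon : P.Monic := Lagrange.nodal_monic
  have hlead : P.coeff e = 1 := by rw [← hdeg]; exact hmon
  have hco : ∀ j, (Polynomial.X * Polynomial.derivative P - Polynomial.C c
      - Polynomial.C (e : K) * P).coeff j
      = j * P.coeff j - (if j = 0 then c else 0) - e * P.coeff j := by
    intro j
    rcases j with _ | j
    · simp
    · simp [Polynomial.coeff_X_mul, Polynomial.coeff_derivative, Polynomial.coeff_C, mul_comm]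
  have hQ : Polynomial.X * Polynomial.derivative P - Polynomial.C c
      - Polynomial.C (e : K) * P = 0 := by
    refine Polynomial.eq_zero_of_degree_lt_of_eval_index_eq_zero (s := Finset.univ) (v := u)
      huinj.injOn ?_ ?_
    · rw [Finset.card_univ, Fintype.card_fin, Polynomial.degree_lt_iff_coeff_zero]
      intro m hm
      rw [hco, if_neg (by omega)]
      rcases hm.eq_or_lt with rfl | hm
      · ring
      · rw [Polynomial.coeff_eq_zero_of_natDegree_lt (by omega)]; ring
    · intro i hi
      have h1 := Lagrange.eval_nodal_derivative_eval_node_eq (v := u) hi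
      rw [Lagrange.eval_nodal] at h1
      have h2 := Lagrange.eval_nodal_at_node (v := u) hi
      simp only [Polynomial.eval_sub, Polynomial.eval_mul, Polynomial.eval_X, Polynomial.eval_C]
      rw [hP, h1, h2, hc i]
      ring
  have hPe : P = Polynomial.X ^ e + Polynomial.C (P.coeff 0) := by
    ext j
    rw [Polynomial.coeff_add, Polynomial.coeff_X_pow, Polynomial.coeff_C]
    have h := hco j
    rw [hQ, Polynomial.coeff_zero] at h
    by_cases h0 : j = 0
    · subst h0
      rw [if_neg (by omega)]; simp
    · by_cases h1 : j = e
      · subst h1; simp [h0, hlead]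
      · rw [if_neg h0] at h
        have h2 : ((j : K) - e) * P.coeff j = 0 := by rw [sub_mul]; linear_combination -h
        have h3 : (j : K) - e ≠ 0 := sub_ne_zero.mpr (by exact_mod_cast h1)
        simp [h0, h1, (mul_eq_zero.mp h2).resolve_left h3]
  have hpow : ∀ i, u i ^ e = - P.coeff 0 := by
    intro i
    have h2 : P.eval (u i) = 0 := Lagrange.eval_nodal_at_node (v := u) (Finset.mem_univ i)
    rw [hPe] at h2
    simp only [Polynomial.eval_add, Polynomial.eval_pow, Polynomial.eval_X,
      Polynomial.eval_C] at h2
    exact eq_neg_of_add_eq_zero_left h2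
  have hr : ∀ i, (u i / u i0) ^ e = 1 := by
    intro i
    rw [div_pow, hpow i, ← hpow i0]
    exact div_self (pow_ne_zero _ (hu0 i0))
  obtain ⟨ζ, hζ⟩ : ∃ ζ : K, IsPrimitiveRoot ζ e := by
    rw [← card_rootsOfUnity_eq_iff_exists_isPrimitiveRoot]
    refine le_antisymm (card_rootsOfUnity K e) ?_
    let f : Fin e → rootsOfUnity e K := fun i => rootsOfUnity.mkOfPowEq (u i / u i0) (hr i)
    have hf : Function.Injective f := by
      intro i j hij
      have h : ((f i : Kˣ) : K) = ((f j : Kˣ) : K) := by rw [hij]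
      simp only [f, rootsOfUnity.coe_mkOfPowEq] at h
      exact huinj ((div_left_inj' (hu0 i0)).mp h)
    simpa using Nat.card_le_card_of_injective f hf
  refine ⟨u i0, hu0 i0, ζ, hζ, ?_⟩
  have hζ0 : ζ ≠ 0 := hζ.ne_zero (by omega)
  refine Set.eq_of_subset_of_ncard_le ?_ ?_ (Set.finite_range _)
  · rintro _ ⟨i, rfl⟩
    obtain ⟨j, hj, h⟩ := hζ.eq_pow_of_pow_eq_one (ξ := u i / u i0 / ζ)
      (by rw [div_pow, hr, hζ.pow_eq_one, div_one])
    refine ⟨⟨j, hj⟩, ?_⟩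
    have := hu0 i0
    simp only [pow_succ, h]
    field_simp
  · rw [← Set.image_univ, ← Set.image_univ, Set.ncard_image_of_injective _ huinj]
    exact Set.ncard_image_le
end

section
/- Let K be a field of characteristic 0, let e ≥ 1, let u_1, …, u_e ∈ K be pairwise distinct, let f = ∏_{k=1}^e (X − u_k) ∈ K[X], and let c ∈ K. If u_i · f'(u_i) = c for all 1 ≤ i ≤ e (where f' is the formal derivative of f), then all coefficients of X^j in f vanish for 1 ≤ j ≤ e − 1; that is, f = X^e + f(0). -/
/-- Let `K` be a field of characteristic `0`, `e ≥ 1`, `u 1, …, u e ∈ K` pairwise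
distinct, `f = ∏ (X - u k)` and `c ∈ K`.  If `u i · f'(u i) = c` for all `i`, then all
coefficients of `X^j` in `f` vanish for `1 ≤ j ≤ e - 1`. -/
theorem coeffs_vanish_of_const_mul_derivative
    (K : Type*) [Field K] [CharZero K] (e : ℕ) (he : 1 ≤ e)
    (u : Fin e → K) (huinj : Function.Injective u) (c : K)
    (f : Polynomial K) (hf : f = ∏ k : Fin e, (Polynomial.X - Polynomial.C (u k)))
    (hder : ∀ i : Fin e, u i * f.derivative.eval (u i) = c) :
    ∀ j : ℕ, 1 ≤ j → j ≤ e - 1 → f.coeff j = 0 := by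
  have hdeg : f.natDegree = e := by
    rw [hf, Polynomial.natDegree_prod_of_monic _ _ (fun k _ => Polynomial.monic_X_sub_C _)]
    simp
  have hcoeff : ∀ m : ℕ, 1 ≤ m →
      (Polynomial.X * f.derivative - Polynomial.C c - Polynomial.C (e : K) * f).coeff m
        = ((m : K) - e) * f.coeff m := by
    intro m hm
    obtain ⟨n, rfl⟩ : ∃ n, m = n + 1 := ⟨m - 1, by omega⟩
    simp only [Polynomial.coeff_sub, Polynomial.coeff_X_mul, Polynomial.coeff_derivative,
      Polynomial.coeff_C_mul, Polynomial.coeff_C_succ]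
    push_cast
    ring
  have hzero : Polynomial.X * f.derivative - Polynomial.C c - Polynomial.C (e : K) * f = 0 := by
    apply Polynomial.eq_zero_of_degree_lt_of_eval_index_eq_zero (v := u) (s := Finset.univ)
      huinj.injOn
    · rw [Finset.card_univ, Fintype.card_fin, Polynomial.degree_lt_iff_coeff_zero]
      intro m hm
      rw [hcoeff m (le_trans he hm)]
      rcases hm.eq_or_lt with h | h
      · rw [h]; simp
      · rw [Polynomial.coeff_eq_zero_of_natDegree_lt (by omega), mul_zero]
    · intro i _
      have h0 : f.eval (u i) = 0 := by
        rw [hf, Polynomial.eval_prod]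
        exact Finset.prod_eq_zero (Finset.mem_univ i) (by simp)
      simp [hder i, h0]
  intro j hj1 hj2
  have h := hcoeff j hj1
  rw [hzero, Polynomial.coeff_zero] at h
  rcases mul_eq_zero.mp h.symm with h | h
  · have h2 : j = e := by exact_mod_cast sub_eq_zero.mp h
    omega
  · exact h
end

section
/- Let p ≥ 2 and w ≥ 1 be integers with (p, w) ≠ (2, 1), and let e_1, …, e_p be integers with 0 = e_1 < e_2 < … < e_p. For 1 ≤ i ≤ p set f_i = ∏_{k=0}^{w−1} ∏_{j ≠ i} |p·k + e_i − e_j| (the inner product taken over 1 ≤ j ≤ p with j ≠ i). Then f_p > f_{p−1}. -/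
lemma aux_prod_lt {ι : Type*} [DecidableEq ι] (s : Finset ι) (l r : ι → ℕ)
    (h : ∀ i ∈ s, l i ≤ r i) (hr : ∀ i ∈ s, 0 < r i) (hs : ∃ i ∈ s, l i < r i) :
    ∏ i ∈ s, l i < ∏ i ∈ s, r i := by
  obtain ⟨i, hi, hlt⟩ := hs
  rw [← Finset.mul_prod_erase s l hi, ← Finset.mul_prod_erase s r hi]
  have h1 : ∏ x ∈ s.erase i, l x ≤ ∏ x ∈ s.erase i, r x :=
    Finset.prod_le_prod' fun x hx => h x (Finset.mem_of_mem_erase hx)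
  have h2 : 0 < ∏ x ∈ s.erase i, r x :=
    Finset.prod_pos fun x hx => hr x (Finset.mem_of_mem_erase hx)
  exact lt_of_le_of_lt (Nat.mul_le_mul_left _ h1) (Nat.mul_lt_mul_of_pos_right hlt h2)

/-- Let `p ≥ 2`, `w ≥ 1` with `(p,w) ≠ (2,1)`, and let `e 1, …, e p` be integers with
`0 = e 1 < e 2 < … < e p`.  Setting
`f i = ∏_{k=0}^{w-1} ∏_{j ≠ i} |p·k + e i - e j|`, we have `f (p-1) < f p`. -/
theorem f_p_gt_f_p_sub_one
    (p w : ℕ) (hp : 2 ≤ p) (hw : 1 ≤ w) (hpw : ¬(p = 2 ∧ w = 1))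
    (e : ℕ → ℤ) (he1 : e 1 = 0) (hmono : StrictMonoOn e (Set.Icc 1 p)) :
    (∏ k ∈ Finset.range w, ∏ j ∈ (Finset.Icc 1 p).erase (p - 1),
        ((p : ℤ) * (k : ℤ) + e (p - 1) - e j).natAbs) <
    (∏ k ∈ Finset.range w, ∏ j ∈ (Finset.Icc 1 p).erase p,
        ((p : ℤ) * (k : ℤ) + e p - e j).natAbs) := by
  obtain ⟨q, rfl⟩ : ∃ q, p = q + 2 := ⟨p - 2, by omega⟩
  have hq : q + 2 - 1 = q + 1 := by omega
  rw [hq]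
  have hL : (Finset.Icc 1 (q + 2)).erase (q + 1) = insert (q + 2) (Finset.Icc 1 q) := by
    ext x; simp only [Finset.mem_erase, Finset.mem_Icc, Finset.mem_insert]; omega
  have hR : (Finset.Icc 1 (q + 2)).erase (q + 2) = insert (q + 1) (Finset.Icc 1 q) := by
    ext x; simp only [Finset.mem_erase, Finset.mem_Icc, Finset.mem_insert]; omega
  have hd : e (q + 1) < e (q + 2) := hmono ⟨by omega, by omega⟩ ⟨by omega, by omega⟩ (by omega)
  have hj : ∀ j ∈ Finset.Icc 1 q, e j < e (q + 1) := fun j hj => by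
    rw [Finset.mem_Icc] at hj
    exact hmono ⟨by omega, by omega⟩ ⟨by omega, by omega⟩ (by omega)
  have hk : ∀ k : ℕ, (0 : ℤ) ≤ ((q + 2 : ℕ) : ℤ) * (k : ℤ) := fun k => by positivity
  have e1 : ∀ k : ℕ, (((q + 2 : ℕ) : ℤ) * (k : ℤ) + e (q + 1) - e (q + 2)).natAbs ≤
      (((q + 2 : ℕ) : ℤ) * (k : ℤ) + e (q + 2) - e (q + 1)).natAbs := fun k => by
    have := hk k
    generalize ((q + 2 : ℕ) : ℤ) * (k : ℤ) = m at *
    omega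
  have e2 : ∀ k : ℕ, 0 < (((q + 2 : ℕ) : ℤ) * (k : ℤ) + e (q + 2) - e (q + 1)).natAbs :=
    fun k => by
    have := hk k
    generalize ((q + 2 : ℕ) : ℤ) * (k : ℤ) = m at *
    omega
  have e3 : ∀ k : ℕ, ∀ j ∈ Finset.Icc 1 q,
      (((q + 2 : ℕ) : ℤ) * (k : ℤ) + e (q + 1) - e j).natAbs <
      (((q + 2 : ℕ) : ℤ) * (k : ℤ) + e (q + 2) - e j).natAbs := fun k j h => by
    have := hk k
    have := hj j h
    generalize ((q + 2 : ℕ) : ℤ) * (k : ℤ) = m at *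
    omega
  have hn1 : q + 2 ∉ Finset.Icc 1 q := by simp
  have hn2 : q + 1 ∉ Finset.Icc 1 q := by simp
  have e4 : ∀ k : ℕ, 0 < ∏ j ∈ Finset.Icc 1 q,
      (((q + 2 : ℕ) : ℤ) * (k : ℤ) + e (q + 2) - e j).natAbs := fun k =>
    Finset.prod_pos fun j h => lt_of_le_of_lt (Nat.zero_le _) (e3 k j h)
  have e5 : ∀ k : ℕ, ∏ j ∈ Finset.Icc 1 q,
      (((q + 2 : ℕ) : ℤ) * (k : ℤ) + e (q + 1) - e j).natAbs ≤ ∏ j ∈ Finset.Icc 1 q,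
      (((q + 2 : ℕ) : ℤ) * (k : ℤ) + e (q + 2) - e j).natAbs := fun k =>
    Finset.prod_le_prod' fun j h => (e3 k j h).le
  rw [hL, hR]
  simp only [Finset.prod_insert hn1, Finset.prod_insert hn2]
  apply aux_prod_lt
  · intro k _
    exact Nat.mul_le_mul (e1 k) (e5 k)
  · intro k _
    exact Nat.mul_pos (e2 k) (e4 k)
  · by_cases h0 : q = 0
    · refine ⟨1, Finset.mem_range.2 (by omega), ?_⟩
      refine lt_of_le_of_lt (Nat.mul_le_mul_left _ (e5 1)) (Nat.mul_lt_mul_of_pos_right ?_ (e4 1))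
      push_cast
      omega
    · refine ⟨0, Finset.mem_range.2 (by omega), ?_⟩
      refine lt_of_le_of_lt (Nat.mul_le_mul_right _ (e1 0)) (Nat.mul_lt_mul_of_pos_left ?_ (e2 0))
      exact aux_prod_lt _ _ _ (fun j h => (e3 0 j h).le)
        (fun j h => lt_of_le_of_lt (Nat.zero_le _) (e3 0 j h))
        ⟨1, Finset.mem_Icc.2 (by omega), e3 0 1 (Finset.mem_Icc.2 (by omega))⟩
end
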